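/- Let A ∈ ℝ^{d1×d2} (d1 ≥ d2) with nonzero rows and σ_min(A) > 0, let x* satisfy A x* = b, let e_0 = 0 ∈ ℝ^{d1} and e_1, …, e_k ∈ ℝ^{d1}, and let q_0, …, q_k ≥ 0 with Σ_{ℓ=0}^{k} q_ℓ = 1. Consider the process started at x_0 ∈ ℝ^{d2}: at each step, given the current iterate x, a pair (j, ℓ) is chosen with probability (‖A_j‖₂²/‖A‖_F²) · q_ℓ and the next iterate is x − ((⟨A_j, x⟩ − (b_j + e_ℓ(j))) / ‖A_j‖₂²) A_jᵀ. Then the expected squared error after i steps (the finite weighted sum over all length-i choice paths of the squared distance of the resulting iterate to x*) satisfies E‖x_i − x*‖₂² ≤ α^i · ‖x_0 − x*‖₂² + ((1 − α^i)/(1 − α)) · (1/‖A‖_F²) · Σ_{ℓ=1}^{k} q_ℓ · ‖e_ℓ‖₂², where α = 1 − σ_min(A)²/‖A‖_F² ∈ [0, 1). -/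

import Mathlib

/-- The smallest singular value of `M`: the largest `σ ≥ 0` with `‖My‖₂ ≥ σ‖y‖₂` for all `y`. -/
noncomputable def sigmaMin {d1 d2 : ℕ} (M : Matrix (Fin d1) (Fin d2) ℝ) : ℝ :=
  sSup {σ : ℝ | 0 ≤ σ ∧ ∀ y : Fin d2 → ℝ,
    σ * Real.sqrt (∑ i, y i ^ 2) ≤ Real.sqrt (∑ i, (∑ j, M i j * y j) ^ 2)}

/-- The smallest singular value is itself a lower bound for the stretching of a nonempty space. -/
theorem sigmaMin_sq_mul_le {d1 d2 : ℕ} (M : Matrix (Fin d1) (Fin d2) ℝ) (hσ : 0 ≤ sigmaMin M)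
    (y : Fin d2 → ℝ) :
    sigmaMin M ^ 2 * ∑ i, y i ^ 2 ≤ ∑ i, (∑ j, M i j * y j) ^ 2 := by
  have hy : 0 ≤ ∑ i, y i ^ 2 := Finset.sum_nonneg fun i _ => sq_nonneg _
  have hM : 0 ≤ ∑ i, (∑ j, M i j * y j) ^ 2 := Finset.sum_nonneg fun i _ => sq_nonneg _
  rcases hy.eq_or_lt with h0 | hpos
  · rw [← h0, mul_zero]
    exact hM
  · have hs : 0 < Real.sqrt (∑ i, y i ^ 2) := Real.sqrt_pos.2 hpos
    have hle : sigmaMin M ≤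
        Real.sqrt (∑ i, (∑ j, M i j * y j) ^ 2) / Real.sqrt (∑ i, y i ^ 2) := by
      refine csSup_le ⟨0, le_rfl, fun z => ?_⟩ fun σ h => (le_div_iff₀ hs).2 (h.2 y)
      rw [zero_mul]
      exact Real.sqrt_nonneg _
    have h := pow_le_pow_left₀ (mul_nonneg hσ hs.le) ((le_div_iff₀ hs).1 hle) 2
    rwa [mul_pow, Real.sq_sqrt hy, Real.sq_sqrt hM] at h

/-- For a positive smallest singular value the domain is nonzero. -/
theorem pos_of_sigmaMin_pos {d1 d2 : ℕ} (M : Matrix (Fin d1) (Fin d2) ℝ)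
    (hσ : 0 < sigmaMin M) : 0 < d2 := by
  rcases Nat.eq_zero_or_pos d2 with rfl | h
  · have hset : {σ : ℝ | 0 ≤ σ ∧ ∀ y : Fin 0 → ℝ,
        σ * Real.sqrt (∑ i, y i ^ 2) ≤ Real.sqrt (∑ i, (∑ j, M i j * y j) ^ 2)} = Set.Ici 0 := by
      ext σ
      simp
    rw [sigmaMin, hset, Real.sSup_of_not_bddAbove (not_bddAbove_Ici _)] at hσ
    exact absurd hσ (lt_irrefl _)
  · exact h

/-- A positive smallest singular value is at most the Frobenius norm. -/
theorem sigmaMin_sq_le {d1 d2 : ℕ} (M : Matrix (Fin d1) (Fin d2) ℝ) (hσ : 0 < sigmaMin M) :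
    sigmaMin M ^ 2 ≤ ∑ j, ∑ i, M j i ^ 2 := by
  have h2 := pos_of_sigmaMin_pos M hσ
  have h := sigmaMin_sq_mul_le M hσ.le (Pi.single ⟨0, h2⟩ 1)
  simp only [Pi.single_apply, ite_pow, one_pow, ne_eq, OfNat.ofNat_ne_zero, not_false_eq_true,
    zero_pow, Finset.sum_ite_eq', Finset.mem_univ, if_true, mul_one, mul_ite, mul_zero] at h
  exact h.trans (Finset.sum_le_sum fun j _ => Finset.single_le_sum
    (f := fun i => M j i ^ 2) (fun i _ => sq_nonneg _) (Finset.mem_univ _))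

/-- The squared error after a Kaczmarz step with right-hand side perturbed by `ε`. -/
theorem kaczmarz_step_sq_error {ι : Type*} [Fintype ι] (a x z : ι → ℝ) (ε : ℝ)
    (ha : ∑ i, a i ^ 2 ≠ 0) :
    ∑ i, (x i - ((∑ i', a i' * x i') - ((∑ i', a i' * z i') + ε)) / (∑ i', a i' ^ 2) * a i
        - z i) ^ 2
      = ∑ i, (x i - z i) ^ 2 - (∑ i, a i * (x i - z i)) ^ 2 / (∑ i, a i ^ 2)
        + ε ^ 2 / (∑ i, a i ^ 2) := by
  have hg : ∑ i, a i * (x i - z i) = ∑ i, a i * x i - ∑ i, a i * z i := by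
    simp only [mul_sub, Finset.sum_sub_distrib]
  have expand : ∀ t : ℝ, ∑ i, (x i - t * a i - z i) ^ 2
      = ∑ i, (x i - z i) ^ 2 - 2 * t * ∑ i, a i * (x i - z i) + t ^ 2 * ∑ i, a i ^ 2 := by
    intro t
    rw [Finset.mul_sum, Finset.mul_sum, ← Finset.sum_sub_distrib, ← Finset.sum_add_distrib]
    exact Finset.sum_congr rfl fun i _ => by ring
  rw [expand, hg]
  field_simp
  ring

/-- An affine recursive bound for a Markov operator propagates to its iterates. -/
theorem iterate_le_of_affine_bound {X : Type*} (T : (X → ℝ) → X → ℝ) (f : X → ℝ) (α β : ℝ)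
    (hα : 0 ≤ α) (hα1 : α < 1)
    (hmono : ∀ φ ψ : X → ℝ, (∀ x, φ x ≤ ψ x) → ∀ x, T φ x ≤ T ψ x)
    (haff : ∀ (a c : ℝ) x, T (fun y => a * f y + c) x = a * T f x + c)
    (hstep : ∀ x, T f x ≤ α * f x + β) (n : ℕ) (x : X) :
    T^[n] f x ≤ α ^ n * f x + (1 - α ^ n) / (1 - α) * β := by
  induction n generalizing x with
  | zero => simp
  | succ n ih =>
    rw [Function.iterate_succ_apply']
    have h1 : (1 - α) ≠ 0 := by linarith
    calc T (T^[n] f) x ≤ T (fun y => α ^ n * f y + (1 - α ^ n) / (1 - α) * β) x :=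
          hmono _ _ ih x
      _ = α ^ n * T f x + (1 - α ^ n) / (1 - α) * β := haff _ _ x
      _ ≤ α ^ n * (α * f x + β) + (1 - α ^ n) / (1 - α) * β := by
          gcongr
          exact hstep x
      _ = α ^ (n + 1) * f x + (1 - α ^ (n + 1)) / (1 - α) * β := by
          field_simp
          ring

/-- Single-row convergence theorem (Theorem A.1): at each step a
pair `(j, ℓ)` is chosen with probability `(‖A_j‖₂²/‖A‖_F²)·q_ℓ` and the iterate is
updated by the Kaczmarz step for the (possibly corrupted) equation
`⟨A_j, x⟩ = b_j + e_ℓ(j)`.  Encoding the expectation after `i` steps by iterating the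
one-step conditional-expectation operator `T` (so `T^[i] (fun x => ‖x − x*‖₂²) x0` is
the finite weighted sum over all length-`i` choice paths), we have `α ∈ [0, 1)` and
`E‖x_i − x*‖₂² ≤ α^i·‖x_0 − x*‖₂² + ((1 − α^i)/(1 − α))·(1/‖A‖_F²)·∑_{ℓ=1}^{k} q_ℓ‖e_ℓ‖₂²`,
where `α = 1 − σ_min(A)²/‖A‖_F²`. -/
theorem stmt_15 (d1 d2 k : ℕ) (hd : d2 ≤ d1)
    (A : Matrix (Fin d1) (Fin d2) ℝ)
    (hrows : ∀ j, ∑ i, A j i ^ 2 ≠ 0)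
    (hσ : 0 < sigmaMin A)
    (b : Fin d1 → ℝ) (xstar : Fin d2 → ℝ)
    (hsol : ∀ j, ∑ i, A j i * xstar i = b j)
    (e : Fin (k + 1) → Fin d1 → ℝ) (he0 : e 0 = 0)
    (q : Fin (k + 1) → ℝ) (hq : ∀ ℓ, 0 ≤ q ℓ) (hq1 : ∑ ℓ, q ℓ = 1)
    (T : ((Fin d2 → ℝ) → ℝ) → ((Fin d2 → ℝ) → ℝ))
    (hT : ∀ φ x, T φ x =
      ∑ j, ∑ ℓ : Fin (k + 1), ((∑ i, A j i ^ 2) / (∑ j', ∑ i, A j' i ^ 2)) * q ℓ *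
        φ (fun i => x i - ((∑ i', A j i' * x i') - (b j + e ℓ j)) / (∑ i', A j i' ^ 2)
            * A j i)) :
    (0 ≤ 1 - sigmaMin A ^ 2 / (∑ j', ∑ i, A j' i ^ 2)
      ∧ 1 - sigmaMin A ^ 2 / (∑ j', ∑ i, A j' i ^ 2) < 1)
    ∧ ∀ (i : ℕ) (x0 : Fin d2 → ℝ),
        T^[i] (fun x => ∑ j, (x j - xstar j) ^ 2) x0
          ≤ (1 - sigmaMin A ^ 2 / (∑ j', ∑ i, A j' i ^ 2)) ^ i * ∑ j, (x0 j - xstar j) ^ 2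
            + ((1 - (1 - sigmaMin A ^ 2 / (∑ j', ∑ i, A j' i ^ 2)) ^ i)
                / (1 - (1 - sigmaMin A ^ 2 / (∑ j', ∑ i, A j' i ^ 2)))) *
              (1 / (∑ j', ∑ i, A j' i ^ 2)) *
                ∑ ℓ ∈ Finset.univ.erase (0 : Fin (k + 1)), q ℓ * ∑ j, e ℓ j ^ 2 := by
  have hrow : ∀ j, 0 < ∑ i, A j i ^ 2 := fun j =>
    (Finset.sum_nonneg fun i _ => sq_nonneg _).lt_of_ne' (hrows j)
  have hσF := sigmaMin_sq_le A hσ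
  have hbd := sigmaMin_sq_mul_le A hσ.le
  set F : ℝ := ∑ j', ∑ i, A j' i ^ 2 with hF
  have hσ2 : 0 < sigmaMin A ^ 2 := by positivity
  have hFpos : 0 < F := hσ2.trans_le hσF
  have hα : 0 ≤ 1 - sigmaMin A ^ 2 / F := sub_nonneg.2 ((div_le_one hFpos).2 hσF)
  have hα1 : 1 - sigmaMin A ^ 2 / F < 1 := sub_lt_self _ (div_pos hσ2 hFpos)
  have hprob : ∑ j, ∑ ℓ, (∑ i, A j i ^ 2) / F * q ℓ = 1 := by
    simp only [← Finset.mul_sum, hq1, mul_one]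
    rw [← Finset.sum_div, ← hF, div_self hFpos.ne']
  have haff : ∀ (φ : (Fin d2 → ℝ) → ℝ) (a c : ℝ) x, T (fun y => a * φ y + c) x = a * T φ x + c := by
    intro φ a c x
    rw [hT, hT]
    conv_rhs => rw [← mul_one c, ← hprob]
    rw [Finset.mul_sum, Finset.mul_sum, ← Finset.sum_add_distrib]
    simp only [Finset.mul_sum _ _ c, Finset.mul_sum _ _ a, ← Finset.sum_add_distrib]
    exact Finset.sum_congr rfl fun j _ => Finset.sum_congr rfl fun ℓ _ => by ring
  refine ⟨⟨hα, hα1⟩, fun n x0 => ?_⟩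
  rw [mul_assoc]
  refine iterate_le_of_affine_bound T _ _ _ hα hα1 ?_ (haff _) ?_ n x0
  · intro φ ψ h x
    rw [hT, hT]
    gcongr with j _ ℓ _
    · exact mul_nonneg (div_nonneg (hrow j).le hFpos.le) (hq ℓ)
    · exact h _
  · intro x
    have herase : ∑ ℓ ∈ Finset.univ.erase (0 : Fin (k + 1)), q ℓ * ∑ j, e ℓ j ^ 2
        = ∑ ℓ, q ℓ * ∑ j, e ℓ j ^ 2 := Finset.sum_erase _ (by simp [he0])
    have hterm : ∀ j ℓ, (∑ i, A j i ^ 2) / F * q ℓ *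
        ∑ i, (x i - ((∑ i', A j i' * x i') - (b j + e ℓ j)) / (∑ i', A j i' ^ 2) * A j i
          - xstar i) ^ 2
        = (∑ i, A j i ^ 2) / F * q ℓ * ∑ i, (x i - xstar i) ^ 2
          - (∑ i, A j i * (x i - xstar i)) ^ 2 / F * q ℓ + 1 / F * (q ℓ * e ℓ j ^ 2) := by
      intro j ℓ
      rw [← hsol j, kaczmarz_step_sq_error _ _ _ _ (hrows j)]
      have := hrows j
      field_simp
    have hexp : T (fun x => ∑ j, (x j - xstar j) ^ 2) x
        = ∑ i, (x i - xstar i) ^ 2 - (∑ j, (∑ i, A j i * (x i - xstar i)) ^ 2) / F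
          + 1 / F * ∑ ℓ, q ℓ * ∑ j, e ℓ j ^ 2 := by
      rw [hT]
      simp only [hterm, Finset.sum_add_distrib, Finset.sum_sub_distrib]
      congr 1
      · congr 1
        · simp only [← Finset.sum_mul]
          rw [hprob, one_mul]
        · simp only [← Finset.mul_sum, hq1, mul_one, Finset.sum_div]
      · rw [Finset.sum_comm]
        simp only [Finset.mul_sum]
    rw [hexp, herase]
    have h := div_le_div_of_nonneg_right (hbd fun i => x i - xstar i) hFpos.le
    rw [mul_div_right_comm] at h
    linarith
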